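/- Let F be a field and k ≤ n positive integers. Since J_{n,k} is a homogeneous ideal, S_{n,k} = F[x_1,…,x_n]/J_{n,k} is graded, and its Hilbert series satisfies Hilb(S_{n,k};q) = rev_q([k]!_q · Stir_q(n,k)); that is, for every d ≥ 0, the dimension of the degree-d homogeneous component of S_{n,k} equals the coefficient of q^d in the coefficient-reversal of the polynomial [k]!_q · Stir_q(n,k). -/

import Mathlib

open scoped Classical
open MvPolynomial

noncomputable section

namespace OSPHecke

/-- Stirling numbers of the second kind. -/
def stirling : ℕ → ℕ → ℕ
  | 0, 0 => 1
  | 0, _ + 1 => 0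
  | _ + 1, 0 => 0
  | n + 1, k + 1 => stirling n k + (k + 1) * stirling n (k + 1)

/-- The `q`-analogue `[k]_q = 1 + q + ⋯ + q^{k-1}` as a polynomial in `q` over `ℕ`. -/
def qnat (k : ℕ) : Polynomial ℕ := ∑ t ∈ Finset.range k, Polynomial.X ^ t

/-- The `q`-factorial `[k]!_q`. -/
def qfact : ℕ → Polynomial ℕ
  | 0 => 1
  | k + 1 => qnat (k + 1) * qfact k

/-- The `q`-Stirling numbers `Stir_q(n,k)`, defined by
`Stir_q(n,k) = Stir_q(n-1,k-1) + [k]_q · Stir_q(n-1,k)` and `Stir_q(0,k) = δ_{0,k}`. -/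
def qstirling : ℕ → ℕ → Polynomial ℕ
  | 0, 0 => 1
  | 0, _ + 1 => 0
  | _ + 1, 0 => 0
  | n + 1, k + 1 => qstirling n k + qnat (k + 1) * qstirling n (k + 1)

variable (F : Type*) [Field F]

/-- The complete homogeneous symmetric polynomial of degree `d` in the first `m`
variables `x_1, …, x_m` of `F[x_1, …, x_n]` (variables are 0-indexed). -/
def hpoly (n d m : ℕ) : MvPolynomial (Fin n) F :=
  ∑ s ∈ Finset.univ.filter (fun s : Sym (Fin n) d => ∀ j ∈ s.1, (j : ℕ) < m),
    (s.1.map MvPolynomial.X).prod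

/-- The ideal `J_{n,k}` generated by `h_k(x_1), h_k(x_1,x_2), …, h_k(x_1,…,x_n)` and
`e_n(x_n), e_{n-1}(x_n), …, e_{n-k+1}(x_n)`. -/
def Jideal (n k : ℕ) : Ideal (MvPolynomial (Fin n) F) :=
  Ideal.span ({f | ∃ m, 1 ≤ m ∧ m ≤ n ∧ f = hpoly F n k m} ∪
    {f | ∃ d, n - k < d ∧ d ≤ n ∧ f = MvPolynomial.esymm (Fin n) F d})

/-- The neglex order on exponent vectors: `a < b` iff there is a position `j` with
`a j < b j` and `a l = b l` for all `l > j`. -/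
def NeglexLt {n : ℕ} (a b : Fin n → ℕ) : Prop :=
  ∃ j : Fin n, a j < b j ∧ ∀ l, j < l → a l = b l

/-- The value `w(t+1)` of a permutation at the 1-based position `t+1`
(0-based position `t`); extended by `0` outside the range. -/
def permVal {n : ℕ} (w : Equiv.Perm (Fin n)) (t : ℕ) : ℕ :=
  if h : t < n then (w ⟨t, h⟩ : ℕ) else 0

/-- The descent set of a permutation, recorded 1-based:
`Des(w) = {j ∈ [n-1] : w(j) > w(j+1)}`. -/
def permDes {n : ℕ} (w : Equiv.Perm (Fin n)) : Finset ℕ :=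
  (Finset.Ico 1 n).filter fun j => permVal w j < permVal w (j - 1)

/-- The inversion number (= Coxeter length) of a permutation. -/
def invCount {n : ℕ} (w : Equiv.Perm (Fin n)) : ℕ :=
  ((Finset.univ : Finset (Fin n × Fin n)).filter fun p => p.1 < p.2 ∧ w p.2 < w p.1).card

/-- The descent set (1-based) of a sequence `i = (i_1, i_2, …)`, given 0-based as
`i : ℕ → ℕ`: `Des(i) = {j ∈ [n-1] : i_j > i_{j+1}}`. -/
def seqDes (n : ℕ) (i : ℕ → ℕ) : Finset ℕ :=
  (Finset.Ico 1 n).filter fun j => i j < i (j - 1)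

/-- `α` is a composition of `n`. -/
def IsComposition (n : ℕ) (α : List ℕ) : Prop := α.sum = n ∧ ∀ a ∈ α, 0 < a

/-- The descent set of a composition: the partial sums `α_1, α_1+α_2, …`
excluding the total sum. -/
def desComp (α : List ℕ) : Finset ℕ :=
  ((Finset.range α.length).filter fun t => 0 < t).image fun t => (α.take t).sum

/-- The variable `x_{t+1}` (0-based index `t`), extended by `0` out of range. -/
def Xv (n : ℕ) (t : ℕ) : MvPolynomial (Fin n) F :=
  if h : t < n then MvPolynomial.X ⟨t, h⟩ else 0

/-- The adjacent transposition exchanging the 0-based indices `t` and `t+1`. -/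
def adjSwap (n t : ℕ) : Equiv.Perm (Fin n) :=
  if h : t + 1 < n then Equiv.swap ⟨t, Nat.lt_of_succ_lt h⟩ ⟨t + 1, h⟩ else 1

/-- `PibarRel F n t f g` says that `g = π̄_t(f)`, where (0-based indices `t`, `t+1`)
`π̄_t(f) = (x_{t+1}·(f - s_t(f)))/(x_t - x_{t+1}) = π_t(f) - f`; since `F[x]` is an
integral domain such a `g` is unique when it exists (and it always exists). -/
def PibarRel (n t : ℕ) (f g : MvPolynomial (Fin n) F) : Prop :=
  (Xv F n t - Xv F n (t + 1)) * g =
    Xv F n (t + 1) * (f - MvPolynomial.rename (⇑(adjSwap n t)) f)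

/-- The permutation associated to a word of (0-based) adjacent transposition indices. -/
def wordPerm (n : ℕ) (L : List ℕ) : Equiv.Perm (Fin n) := (L.map (adjSwap n)).prod

/-- `L` is a reduced word for `w`. -/
def IsReducedWord (n : ℕ) (L : List ℕ) (w : Equiv.Perm (Fin n)) : Prop :=
  (∀ t ∈ L, t + 1 < n) ∧ wordPerm n L = w ∧
    ∀ L' : List ℕ, (∀ t ∈ L', t + 1 < n) → wordPerm n L' = w → L.length ≤ L'.length

/-- `g` is a chain of successive applications of the operators `π̄` along the word `L`,
applied right-to-left (so `g (t+1) = π̄_{L.reverse[t]} (g t)`). -/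
def PibarChain (n : ℕ) (L : List ℕ) (g : ℕ → MvPolynomial (Fin n) F) : Prop :=
  ∀ t, t < L.length → PibarRel F n (L.reverse.getD t 0) (g t) (g (t + 1))

/-- `p = π̄_w(f)`, computed along some reduced word for `w`. -/
def IsPibarApplied (n : ℕ) (w : Equiv.Perm (Fin n)) (f p : MvPolynomial (Fin n) F) : Prop :=
  ∃ (L : List ℕ) (g : ℕ → MvPolynomial (Fin n) F),
    IsReducedWord n L w ∧ g 0 = f ∧ PibarChain F n L g ∧ g L.length = p

/-- The monomial `x_{α,i} = (∏_{j ∈ Des(α)} x_1⋯x_j) · x_1^{i_1}⋯x_n^{i_n}`. -/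
def xAI (n : ℕ) (α : List ℕ) (i : ℕ → ℕ) : MvPolynomial (Fin n) F :=
  (∏ j ∈ desComp α, ∏ t ∈ Finset.range j, Xv F n t) *
    ∏ t ∈ Finset.range n, Xv F n t ^ i t

/-- The defining conditions for the index set `A_{n,k}`: `α` is a composition of `n`
with `α_1 > n-k`, and `k - ℓ(α) ≥ i_1 ≥ ⋯ ≥ i_{n-k} ≥ 0 = i_{n-k+1} = ⋯ = i_n`
(the sequence `i` is 0-indexed: `i t` is the paper's `i_{t+1}`). -/
def Acond (n k : ℕ) (α : List ℕ) (i : ℕ → ℕ) : Prop :=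
  IsComposition n α ∧ n - k < α.headI ∧ i 0 + α.length ≤ k ∧
    (∀ a b, a ≤ b → b < n - k → i b ≤ i a) ∧ ∀ t, n - k ≤ t → i t = 0

/-- The exponent vector of the generalized Garsia–Stanton monomial `gs_{w,i}`:
the variable `x_{w(t)}` has exponent `#{d ∈ Des(w) : d ≥ t} + i_t` (1-based `t`). -/
def gsExp {n : ℕ} (w : Equiv.Perm (Fin n)) (i : ℕ → ℕ) : Fin n → ℕ := fun m =>
  ((permDes w).filter fun r => (w.symm m : ℕ) + 1 ≤ r).card + i (w.symm m : ℕ)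

/-- The generalized Garsia–Stanton monomial `gs_{w,i}`. -/
def gsMono (n : ℕ) (w : Equiv.Perm (Fin n)) (i : ℕ → ℕ) : MvPolynomial (Fin n) F :=
  ∏ m : Fin n, MvPolynomial.X m ^ gsExp w i m

/-- The condition `k - des(w) > i_1 ≥ ⋯ ≥ i_{n-k} ≥ 0 = i_{n-k+1} = ⋯ = i_n` defining
membership of `gs_{w,i}` in `GS_{n,k}`. -/
def GScond (n k : ℕ) (w : Equiv.Perm (Fin n)) (i : ℕ → ℕ) : Prop :=
  i 0 + (permDes w).card < k ∧ (∀ a b, a ≤ b → b < n - k → i b ≤ i a) ∧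
    ∀ t, n - k ≤ t → i t = 0

/-- An ordered set partition of `[n]` with `k` blocks: a `k`-tuple of nonempty,
pairwise disjoint subsets of `Fin n` covering `Fin n`. -/
def OSP (n k : ℕ) : Type :=
  {B : Fin k → Finset (Fin n) // (∀ j, (B j).Nonempty) ∧
    (∀ j l, j ≠ l → ∀ x, x ∈ B j → x ∉ B l) ∧ ∀ x, ∃ j, x ∈ B j}

/-- Relabelling the letters of an ordered set partition by a permutation. -/
def ospMap {n k : ℕ} (e : Equiv.Perm (Fin n)) (σ : OSP n k) : OSP n k :=
  ⟨fun j => (σ.1 j).image e, by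
    obtain ⟨h1, h2, h3⟩ := σ.2
    refine ⟨fun j => (h1 j).image e, fun j l hjl x hx hx' => ?_, fun x => ?_⟩
    · rcases Finset.mem_image.1 hx with ⟨y, hy, hey⟩
      rcases Finset.mem_image.1 hx' with ⟨y', hy', hey'⟩
      have : y = y' := e.injective (hey.trans hey'.symm)
      exact h2 j l hjl y hy (this ▸ hy')
    · rcases h3 (e.symm x) with ⟨j, hj⟩
      exact ⟨j, Finset.mem_image.2 ⟨e.symm x, hj, e.apply_symm_apply x⟩⟩⟩

/-- `b` lies in a block strictly to the left of the block of `a`. -/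
def leftOf {n k : ℕ} (σ : OSP n k) (a b : Fin n) : Prop :=
  ∃ p q : Fin k, p < q ∧ b ∈ σ.1 p ∧ a ∈ σ.1 q

/-- `a` and `b` lie in the same block. -/
def sameBlock {n k : ℕ} (σ : OSP n k) (a b : Fin n) : Prop :=
  ∃ p : Fin k, a ∈ σ.1 p ∧ b ∈ σ.1 p

/-- The value of the 0-Hecke generator `π` (for the pair of letters `a = i`,
`b = i+1`) on a basis element of `F[OP_{n,k}]`. -/
def heckeImg {n k : ℕ} (a b : Fin n) (σ : OSP n k) : OSP n k →₀ F :=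
  if leftOf σ a b then 0
  else if sameBlock σ a b then Finsupp.single σ 1
  else Finsupp.single σ 1 + Finsupp.single (ospMap (Equiv.swap a b) σ) 1

/-- The 0-Hecke operator `π` on `F[OP_{n,k}]` for the pair of letters `a = i`, `b = i+1`. -/
def heckeOp {n k : ℕ} (a b : Fin n) (f : OSP n k →₀ F) : OSP n k →₀ F :=
  f.sum fun σ c => c • heckeImg F a b σ

/-- The value of the 0-Hecke generator `π̄ = π - 1` on a basis element of `F[OP_{n,k}]`. -/
def pibarImg {n k : ℕ} (a b : Fin n) (σ : OSP n k) : OSP n k →₀ F :=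
  if leftOf σ a b then -Finsupp.single σ 1
  else if sameBlock σ a b then 0
  else Finsupp.single (ospMap (Equiv.swap a b) σ) 1

/-- The 0-Hecke operator `π̄ = π - 1` on `F[OP_{n,k}]`. -/
def pibarOp {n k : ℕ} (a b : Fin n) (f : OSP n k →₀ F) : OSP n k →₀ F :=
  f.sum fun σ c => c • pibarImg F a b σ

/-- `IsShuffle l₁ l₂ l` : `l` is an interleaving of `l₁` and `l₂` preserving the
relative order of the entries of each. -/
inductive IsShuffle : List ℕ → List ℕ → List ℕ → Prop
  | nil : IsShuffle [] [] []
  | left {a l₁ l₂ l} : IsShuffle l₁ l₂ l → IsShuffle (a :: l₁) l₂ (a :: l)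
  | right {a l₁ l₂ l} : IsShuffle l₁ l₂ l → IsShuffle l₁ (a :: l₂) (a :: l)

/-- An `(n,k)`-staircase: a shuffle of `(k-1, k-2, …, 1, 0)` with `n-k` copies of `k-1`. -/
def IsStaircase (n k : ℕ) (s : Fin n → ℕ) : Prop :=
  ∃ L : List ℕ, IsShuffle ((List.range k).reverse) (List.replicate (n - k) (k - 1)) L ∧
    ∀ j : Fin n, s j = L.getD (j : ℕ) 0

/-- `B` is an ordered set partition of `[n]` (`n = α.sum`) of shape `α`. -/
def IsOSPShape (α : List ℕ) (B : Fin α.length → Finset (Fin α.sum)) : Prop :=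
  (∀ j, (B j).card = α.get j) ∧
    (∀ j l, j ≠ l → ∀ x, x ∈ B j → x ∉ B l) ∧ ∀ x, ∃ j, x ∈ B j

/-- The ordered set partition `({1,…,α_1} | {α_1+1,…,α_1+α_2} | ⋯)` of shape `α`,
as a tuple of blocks. -/
def sigma0 (α : List ℕ) : Fin α.length → Finset (Fin α.sum) := fun j =>
  Finset.univ.filter fun x =>
    (α.take (j : ℕ)).sum ≤ (x : ℕ) ∧ (x : ℕ) < (α.take ((j : ℕ) + 1)).sum

section Shape

variable {n ℓ : ℕ}

/-- `b` lies in a block strictly to the left of the block of `a` (tuples of blocks). -/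
def blkLeft (B : Fin ℓ → Finset (Fin n)) (a b : Fin n) : Prop :=
  ∃ p q : Fin ℓ, p < q ∧ b ∈ B p ∧ a ∈ B q

/-- `a` and `b` lie in the same block (tuples of blocks). -/
def blkSame (B : Fin ℓ → Finset (Fin n)) (a b : Fin n) : Prop :=
  ∃ p : Fin ℓ, a ∈ B p ∧ b ∈ B p

/-- The value of the 0-Hecke generator `π` (for letters `a = i`, `b = i+1`) on a basis
element of the free module on tuples of blocks. -/
def shapeImg (a b : Fin n) (B : Fin ℓ → Finset (Fin n)) :
    (Fin ℓ → Finset (Fin n)) →₀ F :=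
  if blkLeft B a b then 0
  else if blkSame B a b then Finsupp.single B 1
  else Finsupp.single B 1 + Finsupp.single (fun j => (B j).image (Equiv.swap a b)) 1

/-- The 0-Hecke operator `π` on the free module on tuples of blocks. -/
def shapeOp (a b : Fin n) (f : (Fin ℓ → Finset (Fin n)) →₀ F) :
    (Fin ℓ → Finset (Fin n)) →₀ F :=
  f.sum fun B c => c • shapeImg F a b B

end Shape

/-- A `k`-tuple of blocks is an ordered set partition of `[n]` with `k` blocks. -/
def IsOSPFun {n k : ℕ} (B : Fin k → Finset (Fin n)) : Prop :=
  (∀ j, (B j).Nonempty) ∧ (∀ j l, j ≠ l → ∀ x, x ∈ B j → x ∉ B l) ∧ ∀ x, ∃ j, x ∈ B j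

/-- The `t`-th block (0-based) of a tuple of blocks, extended by `∅` out of range. -/
def blockExt {n k : ℕ} (B : Fin k → Finset (Fin n)) (t : ℕ) : Finset (Fin n) :=
  if h : t < k then B ⟨t, h⟩ else ∅

/-- The word (values in `{1, …, n}`) obtained by listing the elements of each block in
increasing order, reading the blocks from left to right. -/
def ospWord {n k : ℕ} (B : Fin k → Finset (Fin n)) : List ℕ :=
  (List.finRange k).flatMap fun j => ((B j).sort (· ≤ ·)).map fun x => (x : ℕ) + 1

/-- The major index of a word: the sum of the (1-based) positions `j` with
`L_j > L_{j+1}`. -/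
def wordMaj (L : List ℕ) : ℕ :=
  ∑ j ∈ Finset.range (L.length - 1), if L.getD (j + 1) 0 < L.getD j 0 then j + 1 else 0

/-- The major index of an ordered set partition `σ = (B_1 | ⋯ | B_k)`:
`maj(σ) = maj(w) + ∑_{i : max(B_i) < min(B_{i+1})} (α_1 + ⋯ + α_i - i)`. -/
def ospMaj {n k : ℕ} (B : Fin k → Finset (Fin n)) : ℕ :=
  wordMaj (ospWord B) +
    ∑ t ∈ Finset.range (k - 1),
      if ∀ a ∈ blockExt B t, ∀ b ∈ blockExt B (t + 1), a < b then
        (∑ j ∈ Finset.range (t + 1), (blockExt B j).card) - (t + 1)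
      else 0

/-- The complete homogeneous symmetric function of degree `d` evaluated at field
elements `v_1, …, v_n`. -/
def hval {n : ℕ} (v : Fin n → F) (d : ℕ) : F :=
  ∑ s ∈ (Finset.univ : Finset (Sym (Fin n) d)), (s.1.map v).prod

/-- The elementary symmetric function of degree `d` evaluated at field elements
`v_1, …, v_n` (it vanishes for `d > n`). -/
def esymval {n : ℕ} (v : Fin n → F) (d : ℕ) : F :=
  ∑ t ∈ Finset.powersetCard d Finset.univ, ∏ j ∈ t, v j

end OSPHecke

namespace OSPHecke

/-- The exponent vectors of the standard monomials of the ideal generated by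
`h_k(x_1), …, h_k(x_1, …, x_n)` and `e_n, …, e_{n-s+1}`. -/
def stairs (k : ℕ) : (n s : ℕ) → Finset (Fin n → ℕ)
  | 0, s => if s = 0 then Finset.univ else ∅
  | n + 1, s => (Finset.range k).biUnion fun a =>
      (stairs k n (if a < s then s - 1 else s)).image (Fin.cons a)

lemma mem_stairs_zero {k s : ℕ} {b : Fin 0 → ℕ} : b ∈ stairs k 0 s ↔ s = 0 := by
  by_cases h : s = 0 <;>
    simp only [stairs, h, if_true, if_false, Finset.mem_univ, Finset.notMem_empty]

lemma cons_mem_stairs {k n s a : ℕ} {b : Fin n → ℕ} :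
    (Fin.cons a b : Fin (n + 1) → ℕ) ∈ stairs k (n + 1) s ↔
      a < k ∧ b ∈ stairs k n (if a < s then s - 1 else s) := by
  simp only [stairs, Finset.mem_biUnion, Finset.mem_range, Finset.mem_image]
  constructor
  · rintro ⟨a', ha', b', hb', h⟩
    obtain ⟨rfl, rfl⟩ := Fin.cons_inj.1 h
    exact ⟨ha', hb'⟩
  · rintro ⟨ha, hb⟩
    exact ⟨a, ha, b, hb, rfl⟩

/-- The generating function of `stairs k n s` by degree. -/
def stairPoly (k n s : ℕ) : Polynomial ℕ :=
  ∑ b ∈ stairs k n s, Polynomial.X ^ ∑ i, b i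

lemma coeff_stairPoly (k n s d : ℕ) :
    (stairPoly k n s).coeff d = ((stairs k n s).filter fun b => ∑ i, b i = d).card := by
  rw [stairPoly, Polynomial.finsetSum_coeff, Finset.card_filter]
  simp only [Polynomial.coeff_X_pow, eq_comm]

lemma stairPoly_zero (k s : ℕ) : stairPoly k 0 s = if s = 0 then 1 else 0 := by
  by_cases h : s = 0 <;> simp [stairPoly, stairs, h]

lemma stairPoly_succ_eq_sum (k n s : ℕ) :
    stairPoly k (n + 1) s = ∑ a ∈ Finset.range k,
      Polynomial.X ^ a * stairPoly k n (if a < s then s - 1 else s) := by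
  rw [stairPoly, stairs, Finset.sum_biUnion]
  · refine Finset.sum_congr rfl fun a _ => ?_
    rw [Finset.sum_image fun x _ y _ h => (Fin.cons_inj.1 h).2, stairPoly, Finset.mul_sum]
    refine Finset.sum_congr rfl fun b _ => ?_
    rw [Fin.sum_univ_succ, pow_add]
    simp
  · intro a _ a' _ h
    simp only [Function.onFun, Finset.disjoint_left, Finset.mem_image]
    rintro _ ⟨b, _, rfl⟩ ⟨b', _, h'⟩
    exact h (Fin.cons_inj.1 h').1.symm

lemma qnat_zero : qnat 0 = 0 := by simp [qnat]

lemma qnat_succ (k : ℕ) : qnat (k + 1) = qnat k + Polynomial.X ^ k :=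
  Finset.sum_range_succ _ _

lemma qnat_succ' (k : ℕ) : qnat (k + 1) = 1 + Polynomial.X * qnat k := by
  simp only [qnat, Finset.sum_range_succ', Finset.mul_sum]
  rw [add_comm]
  simp [pow_succ']

lemma stairPoly_succ {k s : ℕ} (n : ℕ) (h : s ≤ k) :
    stairPoly k (n + 1) s = qnat s * stairPoly k n (s - 1) +
      Polynomial.X ^ s * qnat (k - s) * stairPoly k n s := by
  obtain ⟨m, rfl⟩ := Nat.exists_eq_add_of_le h
  rw [stairPoly_succ_eq_sum, Finset.sum_range_add, qnat, qnat, Finset.sum_mul, Finset.mul_sum,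
    Finset.sum_mul, Nat.add_sub_cancel_left]
  congr 1
  · exact Finset.sum_congr rfl fun a ha => by rw [if_pos (Finset.mem_range.1 ha)]
  · exact Finset.sum_congr rfl fun a _ => by rw [if_neg (by omega), pow_add]

lemma stairPoly_eq_zero {k n s : ℕ} (h : n < s) : stairPoly k n s = 0 := by
  induction n generalizing s with
  | zero => rw [stairPoly_zero, if_neg (by omega)]
  | succ n ih =>
    rw [stairPoly_succ_eq_sum]
    refine Finset.sum_eq_zero fun a _ => ?_
    rw [ih (by split_ifs <;> omega), mul_zero]

lemma stairPoly_eval_zero {k n s : ℕ} (hk : 1 ≤ k) (h : s ≤ n) :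
    (stairPoly k n s).eval 0 = 1 := by
  induction n generalizing s with
  | zero => rw [stairPoly_zero, if_pos (by omega), Polynomial.eval_one]
  | succ n ih =>
    obtain ⟨k, rfl⟩ := Nat.exists_eq_add_of_le' hk
    rw [stairPoly_succ_eq_sum, Finset.sum_range_succ', Polynomial.eval_add,
      Polynomial.eval_finsetSum]
    simp only [pow_succ, Polynomial.eval_mul, Polynomial.eval_X, mul_zero, zero_mul,
      Finset.sum_const_zero, zero_add, pow_zero, one_mul]
    exact ih (by split_ifs <;> omega)

/-- The recursion in the number of elementary symmetric generators. -/
lemma stairPoly_succ_left {k s : ℕ} (n : ℕ) (h : s ≤ k) :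
    stairPoly (k + 1) n s =
      stairPoly (k + 1) n (s + 1) + Polynomial.X ^ (n - s) * stairPoly k n s := by
  induction n generalizing s with
  | zero =>
    by_cases hs : s = 0 <;> simp [stairPoly_zero, hs]
  | succ n ih =>
    rw [stairPoly_succ n (show s ≤ k + 1 by omega), stairPoly_succ n (show s + 1 ≤ k + 1 by omega),
      stairPoly_succ n h, show k + 1 - s = (k - s) + 1 by omega, qnat_succ' (k - s),
      show k + 1 - (s + 1) = k - s by omega, qnat_succ s, Nat.add_sub_cancel]
    have h1 : qnat s * stairPoly (k + 1) n (s - 1) = qnat s * (stairPoly (k + 1) n s +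
        Polynomial.X ^ (n + 1 - s) * stairPoly k n (s - 1)) := by
      rcases Nat.eq_zero_or_pos s with rfl | hs
      · simp [qnat_zero]
      · rw [ih (show s - 1 ≤ k by omega), show s - 1 + 1 = s by omega,
          show n - (s - 1) = n + 1 - s by omega]
    have h2 : stairPoly (k + 1) n s = stairPoly (k + 1) n (s + 1) +
        Polynomial.X ^ (n - s) * stairPoly k n s := ih h
    have h3 : (Polynomial.X : Polynomial ℕ) ^ (n + 1 - s) * (Polynomial.X ^ s * stairPoly k n s) =
        Polynomial.X ^ (s + 1) * (Polynomial.X ^ (n - s) * stairPoly k n s) := by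
      by_cases hs : s ≤ n
      · rw [← mul_assoc, ← mul_assoc, ← pow_add, ← pow_add]
        congr 2
        omega
      · rw [stairPoly_eq_zero (by omega)]
        simp
    calc _ = qnat s * stairPoly (k + 1) n s + Polynomial.X ^ s * stairPoly (k + 1) n s
          + Polynomial.X ^ (s + 1) * qnat (k - s) * stairPoly (k + 1) n s
          + qnat s * (Polynomial.X ^ (n + 1 - s) * stairPoly k n (s - 1)) := by
            rw [h1]; ring
      _ = qnat s * stairPoly (k + 1) n s + Polynomial.X ^ s * stairPoly (k + 1) n s
          + Polynomial.X ^ (s + 1) * qnat (k - s) * (stairPoly (k + 1) n (s + 1) +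
            Polynomial.X ^ (n - s) * stairPoly k n s)
          + qnat s * (Polynomial.X ^ (n + 1 - s) * stairPoly k n (s - 1)) := by rw [← h2]
      _ = qnat s * stairPoly (k + 1) n s + Polynomial.X ^ s * stairPoly (k + 1) n s
          + Polynomial.X ^ (s + 1) * qnat (k - s) * stairPoly (k + 1) n (s + 1)
          + qnat (k - s) * (Polynomial.X ^ (s + 1) * (Polynomial.X ^ (n - s) * stairPoly k n s))
          + qnat s * (Polynomial.X ^ (n + 1 - s) * stairPoly k n (s - 1)) := by ring
      _ = _ := by rw [← h3]; ring

lemma stairPoly_diag_succ {k m : ℕ} :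
    stairPoly (k + 1) (k + 1 + m) (k + 1) = qnat (k + 1) *
      (stairPoly (k + 1) (k + m) (k + 1) + Polynomial.X ^ m * stairPoly k (k + m) k) := by
  rw [show k + 1 + m = k + m + 1 by omega, stairPoly_succ _ le_rfl, Nat.sub_self, qnat_zero,
    mul_zero, zero_mul, add_zero, Nat.add_sub_cancel, stairPoly_succ_left _ le_rfl,
    Nat.add_sub_cancel_left]

lemma qstirling_eq_zero {n k : ℕ} (h : n < k) : qstirling n k = 0 := by
  induction n generalizing k with
  | zero =>
    obtain ⟨k, rfl⟩ := Nat.exists_eq_add_of_lt h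
    simp [qstirling]
  | succ n ih =>
    obtain ⟨k, rfl⟩ := Nat.exists_eq_add_of_le' (show 1 ≤ k by omega)
    rw [qstirling, ih (by omega), ih (by omega), mul_zero, add_zero]

lemma qfact_mul_qstirling_succ (n k : ℕ) :
    qfact (k + 1) * qstirling (n + 1) (k + 1) =
      qnat (k + 1) * (qfact (k + 1) * qstirling n (k + 1) + qfact k * qstirling n k) := by
  rw [qstirling, qfact]
  ring

lemma natDegree_qnat_succ_le (k : ℕ) : (qnat (k + 1)).natDegree ≤ k :=
  Polynomial.natDegree_sum_le_of_forall_le _ _ fun a ha => by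
    rw [Polynomial.natDegree_X_pow]
    have := Finset.mem_range.1 ha
    omega

lemma reflect_qnat_succ (k : ℕ) : Polynomial.reflect k (qnat (k + 1)) = qnat (k + 1) := by
  ext i
  have h : ∀ i, (qnat (k + 1)).coeff i = if i ≤ k then 1 else 0 := fun i => by
    simp [qnat, Polynomial.coeff_X_pow]
  rw [Polynomial.coeff_reflect, h, h]
  by_cases hi : i ≤ k
  · rw [Polynomial.revAt_le hi, if_pos hi, if_pos (by omega)]
  · rw [Polynomial.revAt_eq_self_of_lt (by omega)]

lemma reflect_add_left {N m : ℕ} {p : Polynomial ℕ} (h : p.natDegree ≤ N) :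
    Polynomial.reflect (m + N) p = Polynomial.X ^ m * Polynomial.reflect N p := by
  have := Polynomial.reflect_mul (1 : Polynomial ℕ) p (F := m) (by simp) h
  rwa [one_mul, Polynomial.reflect_one] at this

/-- The degree of `[k]!_q · Stir_q(k + m, k)`. -/
def topDegree (k m : ℕ) : ℕ := (k - 1) * m + ∑ i ∈ Finset.range k, i

lemma reflect_qfact_mul_qstirling (k m : ℕ) :
    (qfact k * qstirling (k + m) k).natDegree ≤ topDegree k m ∧
      Polynomial.reflect (topDegree k m) (qfact k * qstirling (k + m) k) =
        stairPoly k (k + m) k := by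
  induction k generalizing m with
  | zero =>
    cases m with
    | zero => simp [qfact, qstirling, stairPoly_zero, topDegree, Polynomial.reflect_one]
    | succ m => simp [qfact, qstirling, stairPoly_succ, qnat_zero]
  | succ k ihk =>
    have key : ∀ (N m : ℕ) (p r r' : Polynomial ℕ), N + k = topDegree (k + 1) m →
        p.natDegree ≤ N → Polynomial.reflect N p = r →
        r + Polynomial.X ^ m * stairPoly k (k + m) k = r' →
        (qnat (k + 1) * (p + qfact k * qstirling (k + m) k)).natDegree ≤ topDegree (k + 1) m ∧
        Polynomial.reflect (topDegree (k + 1) m)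
          (qnat (k + 1) * (p + qfact k * qstirling (k + m) k)) = qnat (k + 1) * r' := by
      intro N m p r r' hN hp hr hr'
      have hA : (qfact k * qstirling (k + m) k).natDegree ≤ N ∧
          Polynomial.reflect N (qfact k * qstirling (k + m) k) =
            Polynomial.X ^ m * stairPoly k (k + m) k := by
        rcases Nat.eq_zero_or_pos k with rfl | hk
        · cases m with
          | zero =>
            have : N = 0 := by simpa [topDegree] using hN
            subst this
            simp [qfact, qstirling, stairPoly_zero, Polynomial.reflect_one]
          | succ m => simp [qfact, qstirling, stairPoly_succ, qnat_zero]
        · obtain ⟨h1, h2⟩ := ihk m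
          have : N = m + topDegree k m := by
            obtain ⟨k, rfl⟩ := Nat.exists_eq_add_of_le' hk
            simp only [topDegree, Finset.sum_range_succ, Nat.add_sub_cancel] at hN ⊢
            linarith
          subst this
          exact ⟨by omega, by rw [reflect_add_left h1, h2]⟩
      have hs : (p + qfact k * qstirling (k + m) k).natDegree ≤ N :=
        (Polynomial.natDegree_add_le _ _).trans (max_le hp hA.1)
      rw [← hN, add_comm N k]
      refine ⟨Polynomial.natDegree_mul_le.trans (add_le_add (natDegree_qnat_succ_le k) hs), ?_⟩
      rw [Polynomial.reflect_mul _ _ (natDegree_qnat_succ_le k) hs, reflect_qnat_succ,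
        Polynomial.reflect_add, hr, hA.2, hr']
    induction m with
    | zero =>
      rw [stairPoly_diag_succ, add_right_comm, qfact_mul_qstirling_succ]
      refine key (∑ i ∈ Finset.range k, i) 0 _ 0 _ ?_ ?_ ?_ ?_
      · simp [topDegree, Finset.sum_range_succ]
      · simp [qstirling_eq_zero]
      · simp [qstirling_eq_zero]
      · rw [stairPoly_eq_zero (show k + 0 < k + 1 by omega)]
    | succ m ih =>
      rw [stairPoly_diag_succ, add_right_comm, qfact_mul_qstirling_succ]
      have e : k + (m + 1) = k + 1 + m := by omega
      refine key (topDegree (k + 1) m) (m + 1) _ _ _ ?_ ?_ ?_ rfl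
      · simp only [topDegree, Nat.add_sub_cancel]
        ring
      · rw [e]; exact ih.1
      · rw [e]; exact ih.2

lemma reverse_qfact_mul_qstirling {n k : ℕ} (hk : 1 ≤ k) (hkn : k ≤ n) :
    (qfact k * qstirling n k).reverse = stairPoly k n k := by
  obtain ⟨m, rfl⟩ := Nat.exists_eq_add_of_le hkn
  obtain ⟨h1, h2⟩ := reflect_qfact_mul_qstirling k m
  have h3 : (qfact k * qstirling (k + m) k).coeff (topDegree k m) = 1 := by
    rw [← stairPoly_eval_zero hk hkn, ← h2, ← Polynomial.coeff_zero_eq_eval_zero,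
      Polynomial.coeff_reflect, Polynomial.revAt_zero]
  have h4 : (qfact k * qstirling (k + m) k).natDegree = topDegree k m :=
    le_antisymm h1 (Polynomial.le_natDegree_of_ne_zero (by rw [h3]; exact one_ne_zero))
  rw [Polynomial.reverse, h4, h2]

section Ideals

variable (F : Type*) [Field F]

lemma hpoly_eq_sum_monomial (n d m : ℕ) :
    hpoly F n d m = ∑ s ∈ Finset.univ.filter (fun s : Sym (Fin n) d => ∀ j ∈ s.1, (j : ℕ) < m),
      monomial (Multiset.toFinsupp s.1) 1 := by
  refine Finset.sum_congr rfl fun s _ => ?_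
  induction s.1 using Multiset.induction_on with
  | empty => simp
  | cons a t ih =>
    rw [Multiset.map_cons, Multiset.prod_cons, ih, ← Multiset.singleton_add, map_add,
      Multiset.toFinsupp_singleton, X, monomial_mul, one_mul]

lemma coeff_hpoly (n d m : ℕ) (a : Fin n →₀ ℕ) :
    coeff a (hpoly F n d m) =
      if a.degree = d ∧ ∀ j : Fin n, a j ≠ 0 → (j : ℕ) < m then 1 else 0 := by
  have hcard : ∀ a : Fin n →₀ ℕ, (Finsupp.toMultiset a).card = a.degree := fun a => by
    rw [Finsupp.card_toMultiset]; rfl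
  rw [hpoly_eq_sum_monomial, coeff_sum]
  simp only [coeff_monomial]
  split_ifs with h
  · rw [Finset.sum_eq_single ⟨Finsupp.toMultiset a, (hcard a).trans h.1⟩]
    · simp
    · intro s _ hs
      refine if_neg fun hsa => hs (Subtype.ext ?_)
      have := congrArg Finsupp.toMultiset hsa
      rwa [Multiset.toFinsupp_toMultiset] at this
    · intro hs
      refine absurd (Finset.mem_filter.2 ⟨Finset.mem_univ _, fun j hj => h.2 j ?_⟩) hs
      exact Finsupp.mem_support_iff.1 (Finsupp.mem_toMultiset _ _ |>.1 hj)
  · refine Finset.sum_eq_zero fun s hs => if_neg fun hsa => h ?_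
    have hs' : Finsupp.toMultiset a = s.1 := by rw [← hsa, Multiset.toFinsupp_toMultiset]
    refine ⟨by rw [← hcard, hs', s.2], fun j hj => (Finset.mem_filter.1 hs).2 j ?_⟩
    rw [← hs', Finsupp.mem_toMultiset]
    exact Finsupp.mem_support_iff.2 hj

lemma hpoly_isHomogeneous (n d m : ℕ) : (hpoly F n d m).IsHomogeneous d := by
  intro a ha
  rw [coeff_hpoly] at ha
  by_contra h
  refine ha (if_neg fun h' => h ?_)
  rw [← h'.1, Finsupp.degree_eq_weight_one]
  rfl

lemma hpoly_zero (n m : ℕ) : hpoly F n 0 m = 1 := by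
  ext a
  rw [coeff_hpoly, coeff_one]
  by_cases h : a = 0
  · subst h; simp
  · rw [if_neg fun h' => h ((Finsupp.degree_eq_zero_iff a).1 h'.1), if_neg (Ne.symm h)]

lemma hpoly_succ_zero (n d : ℕ) : hpoly F n (d + 1) 0 = 0 := by
  ext a
  rw [coeff_hpoly, coeff_zero]
  refine if_neg fun h => ?_
  have : a = 0 := Finsupp.ext fun j => by
    by_contra hj
    exact Nat.not_lt_zero _ (h.2 j hj)
  simp [this] at h

lemma hpoly_succ (n d m : ℕ) :
    hpoly F (n + 1) (d + 1) (m + 1) =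
      rename Fin.succ (hpoly F n (d + 1) m) + X 0 * hpoly F (n + 1) d (m + 1) := by
  ext a
  rw [coeff_add, coeff_X_mul', coeff_hpoly]
  by_cases ha : a 0 = 0
  · rw [if_neg (Finsupp.notMem_support_iff.2 ha), add_zero]
    have e : a = (Finsupp.tail a).mapDomain Fin.succ := by
      ext j
      refine Fin.cases ?_ (fun j => ?_) j
      · rw [ha, Finsupp.mapDomain_of_notMem_range]
        rintro ⟨i, hi⟩
        exact Fin.succ_ne_zero i hi
      · rw [Finsupp.mapDomain_apply (Fin.succ_injective n), Finsupp.tail_apply]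
    have hdeg : a.degree = (Finsupp.tail a).degree := by
      rw [Finsupp.degree_eq_sum, Finsupp.degree_eq_sum, Fin.sum_univ_succ, ha, zero_add]
      rfl
    conv_rhs => rw [e]
    rw [coeff_rename_mapDomain _ (Fin.succ_injective n), coeff_hpoly, hdeg]
    congr 2
    rw [Fin.forall_fin_succ]
    simp [ha, Finsupp.tail_apply]
  · rw [if_pos (Finsupp.mem_support_iff.2 ha), coeff_rename_eq_zero, zero_add, coeff_hpoly]
    · have e : a = (a - Finsupp.single 0 1) + Finsupp.single 0 1 :=
        (tsub_add_cancel_of_le (by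
          rw [Finsupp.single_le_iff]; omega)).symm
      have hdeg : a.degree = (a - Finsupp.single 0 1).degree + 1 := by
        conv_lhs => rw [e]
        rw [map_add, Finsupp.degree_single]
      refine if_congr (and_congr (by omega) ?_) rfl rfl
      rw [Fin.forall_fin_succ, Fin.forall_fin_succ]
      simp
    · intro u hu
      exfalso
      apply ha
      rw [← hu, Finsupp.mapDomain_of_notMem_range]
      rintro ⟨i, hi⟩
      exact Fin.succ_ne_zero i hi

lemma esymm_fin_succ (n d : ℕ) :
    esymm (Fin (n + 1)) F (d + 1) =
      rename Fin.succ (esymm (Fin n) F (d + 1)) + X 0 * rename Fin.succ (esymm (Fin n) F d) := by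
  have h : ∀ d, rename Fin.succ (esymm (Fin n) F d) =
      (Finset.univ.val.map fun i : Fin n => (X i.succ : MvPolynomial (Fin (n + 1)) F)).esymm d := by
    intro d
    rw [Finset.esymm_map_val, esymm, map_sum]
    simp [map_prod]
  rw [h, h, esymm_eq_multiset_esymm, Fin.univ_succ, Finset.cons_val, Multiset.map_cons,
    Finset.map_val, Multiset.map_map]
  simp only [Multiset.esymm, Multiset.powersetCard_cons, Multiset.map_map, Function.comp_def,
    Multiset.sum_map_mul_left, Multiset.map_add, Multiset.sum_add, Multiset.prod_cons]
  rfl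

lemma esymm_fin_eq_zero {n d : ℕ} (h : n < d) : esymm (Fin n) F d = 0 := by
  rw [esymm, Finset.powersetCard_eq_empty.2 (by simpa using h), Finset.sum_empty]

/-- The ideal generated by `h_k(x_1), …, h_k(x_1, …, x_n)` and `e_n, …, e_{n-s+1}`. -/
def skipIdeal (n k s : ℕ) : Ideal (MvPolynomial (Fin n) F) :=
  Ideal.span ({f | ∃ m ≤ n, f = hpoly F n k m} ∪
    {f | ∃ d, n < d + s ∧ f = esymm (Fin n) F d})

lemma Jideal_eq_skipIdeal {n k : ℕ} (hk : 1 ≤ k) (hkn : k ≤ n) :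
    Jideal F n k = skipIdeal F n k k := by
  apply le_antisymm
  · refine Ideal.span_mono (Set.union_subset_union ?_ ?_)
    · rintro f ⟨m, _, hm, rfl⟩
      exact ⟨m, hm, rfl⟩
    · rintro f ⟨d, hd, _, rfl⟩
      exact ⟨d, by omega, rfl⟩
  · rw [skipIdeal, Ideal.span_le]
    rintro f (⟨m, hm, rfl⟩ | ⟨d, hd, rfl⟩)
    · rcases Nat.eq_zero_or_pos m with rfl | h
      · obtain ⟨k, rfl⟩ := Nat.exists_eq_add_of_le' hk
        rw [hpoly_succ_zero]
        exact zero_mem _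
      · exact Ideal.subset_span (Or.inl ⟨m, h, hm, rfl⟩)
    · by_cases h : d ≤ n
      · exact Ideal.subset_span (Or.inr ⟨d, by omega, h, rfl⟩)
      · rw [esymm_fin_eq_zero F (by omega)]
        exact zero_mem _

variable {F}

lemma hpoly_mem_skipIdeal {n k s m : ℕ} (hm : m ≤ n) : hpoly F n k m ∈ skipIdeal F n k s :=
  Ideal.subset_span (Or.inl ⟨m, hm, rfl⟩)

lemma esymm_mem_skipIdeal {n k s d : ℕ} (hd : n < d + s) :
    esymm (Fin n) F d ∈ skipIdeal F n k s :=
  Ideal.subset_span (Or.inr ⟨d, hd, rfl⟩)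

lemma X_zero_pow_mem_skipIdeal (n k s : ℕ) : (X 0 : MvPolynomial (Fin (n + 1)) F) ^ k ∈
    skipIdeal F (n + 1) k s := by
  have h : ∀ d, hpoly F (n + 1) d 1 = X 0 ^ d := fun d => by
    induction d with
    | zero => rw [hpoly_zero, pow_zero]
    | succ d ih => rw [hpoly_succ, hpoly_succ_zero, map_zero, zero_add, ih, pow_succ']
  rw [← h]
  exact hpoly_mem_skipIdeal (by omega)

lemma X_zero_pow_mul_esymm_mem (n k : ℕ) {s i : ℕ} (hi : i ≤ s) (hin : i ≤ n + 1) :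
    X 0 ^ i * rename Fin.succ (esymm (Fin n) F (n + 1 - i)) ∈ skipIdeal F (n + 1) k s := by
  induction i with
  | zero => rw [esymm_fin_eq_zero F (by omega)]; simp
  | succ i ih =>
    have h := esymm_fin_succ F n (n - i)
    rw [show n - i + 1 = n + 1 - i by omega] at h
    have h' : X 0 ^ (i + 1) * rename Fin.succ (esymm (Fin n) F (n - i)) =
        X 0 ^ i * esymm (Fin (n + 1)) F (n + 1 - i) -
          X 0 ^ i * rename Fin.succ (esymm (Fin n) F (n + 1 - i)) := by
      rw [h]; ring
    rw [Nat.add_sub_add_right, h']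
    exact sub_mem (Ideal.mul_mem_left _ _ (esymm_mem_skipIdeal (by omega)))
      (ih (by omega) (by omega))

lemma X_zero_pow_mul_rename_mem {n k s a : ℕ} (hk : 1 ≤ k) {f : MvPolynomial (Fin n) F}
    (hf : f ∈ skipIdeal F n k (if a < s then s - 1 else s)) :
    X 0 ^ a * rename Fin.succ f ∈ skipIdeal F (n + 1) k s ⊔ Ideal.span {X 0 ^ (a + 1)} := by
  have hX : ∀ g : MvPolynomial (Fin (n + 1)) F,
      X 0 ^ (a + 1) * g ∈ skipIdeal F (n + 1) k s ⊔ Ideal.span {X 0 ^ (a + 1)} := fun g =>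
    Ideal.mem_sup_right (Ideal.mul_mem_right _ _ (Ideal.mem_span_singleton_self _))
  rw [skipIdeal] at hf
  induction hf using Submodule.span_induction with
  | zero => simp
  | add f g _ _ hf hg => rw [map_add, mul_add]; exact add_mem hf hg
  | smul p f _ hf =>
    rw [smul_eq_mul, map_mul, mul_left_comm]
    exact Ideal.mul_mem_left _ _ hf
  | mem f hf =>
    rcases hf with ⟨m, hm, rfl⟩ | ⟨d, hd, rfl⟩
    · obtain ⟨k, rfl⟩ := Nat.exists_eq_add_of_le' hk
      have h : X 0 ^ a * rename Fin.succ (hpoly F n (k + 1) m) =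
          X 0 ^ a * hpoly F (n + 1) (k + 1) (m + 1) -
            X 0 ^ (a + 1) * hpoly F (n + 1) k (m + 1) := by
        rw [hpoly_succ]; ring
      rw [h]
      exact sub_mem (Ideal.mem_sup_left (Ideal.mul_mem_left _ _ (hpoly_mem_skipIdeal (by omega))))
        (hX _)
    · by_cases hd' : n + 1 < d + s
      · cases d with
        | zero =>
          have := esymm_mem_skipIdeal (F := F) (k := k) hd'
          rw [esymm_zero] at this ⊢
          rw [map_one]
          exact Ideal.mem_sup_left (Ideal.mul_mem_left _ _ this)
        | succ d =>
          have h : X 0 ^ a * rename Fin.succ (esymm (Fin n) F (d + 1)) =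
              X 0 ^ a * esymm (Fin (n + 1)) F (d + 1) -
                X 0 ^ (a + 1) * rename Fin.succ (esymm (Fin n) F d) := by
            rw [esymm_fin_succ]; ring
          rw [h]
          exact sub_mem (Ideal.mem_sup_left (Ideal.mul_mem_left _ _ (esymm_mem_skipIdeal hd')))
            (hX _)
      · have ha : s ≤ a := by
          by_contra h
          rw [if_pos (by omega)] at hd
          omega
        rw [if_neg (by omega)] at hd
        obtain ⟨b, rfl⟩ := Nat.exists_eq_add_of_le ha
        rw [pow_add _ s b, mul_right_comm, show d = n + 1 - s by omega]
        exact Ideal.mem_sup_left (Ideal.mul_mem_right _ _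
          (X_zero_pow_mul_esymm_mem n k le_rfl (by omega)))

variable (F) in
/-- The monomial with exponent vector `b`. -/
def expMono {n : ℕ} (b : Fin n → ℕ) : MvPolynomial (Fin n) F :=
  ∏ i, X i ^ b i

lemma expMono_cons {n : ℕ} (a : ℕ) (b : Fin n → ℕ) :
    expMono F (Fin.cons a b : Fin (n + 1) → ℕ) = X 0 ^ a * rename Fin.succ (expMono F b) := by
  simp [expMono, Fin.prod_univ_succ]

lemma expMono_isHomogeneous {n : ℕ} (b : Fin n → ℕ) :
    (expMono F b).IsHomogeneous (∑ i, b i) :=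
  IsHomogeneous.prod _ _ _ fun i _ => isHomogeneous_X_pow i (b i)

lemma exists_eq_X_zero_mul_add_rename {n : ℕ} (f : MvPolynomial (Fin (n + 1)) F) :
    ∃ g f', f = X 0 * g + rename Fin.succ f' := by
  induction f using MvPolynomial.induction_on with
  | C a => exact ⟨0, C a, by simp⟩
  | add p q hp hq =>
    obtain ⟨g, f, rfl⟩ := hp
    obtain ⟨g', f', rfl⟩ := hq
    exact ⟨g + g', f + f', by rw [map_add]; ring⟩
  | mul_X p i hp =>
    obtain ⟨g, f, rfl⟩ := hp
    refine Fin.cases ⟨X 0 * g + rename Fin.succ f, 0, by rw [map_zero]; ring⟩ (fun i => ?_) i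
    exact ⟨g * X i.succ, f * X i, by rw [map_mul, rename_X]; ring⟩

lemma mem_span_expMono_sup_skipIdeal {k : ℕ} (hk : 1 ≤ k) (n s : ℕ)
    (f : MvPolynomial (Fin n) F) :
    f ∈ Submodule.span F (expMono F '' stairs k n s) ⊔ (skipIdeal F n k s).restrictScalars F := by
  induction n generalizing s with
  | zero =>
    by_cases hs : s = 0
    · subst hs
      rw [eq_C_of_isEmpty f]
      refine Submodule.mem_sup_left ?_
      rw [← mul_one (C _), ← smul_eq_C_mul]
      refine Submodule.smul_mem _ _ (Submodule.subset_span ⟨default, ?_, ?_⟩)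
      · simp [mem_stairs_zero]
      · simp [expMono]
    · have h1 := esymm_mem_skipIdeal (F := F) (n := 0) (k := k) (s := s) (d := 0) (by omega)
      rw [esymm_zero] at h1
      refine Submodule.mem_sup_right ?_
      rw [(Ideal.eq_top_iff_one _).2 h1]
      trivial
  | succ n ih =>
    set W := Submodule.span F (expMono F '' stairs k (n + 1) s) ⊔
      (skipIdeal F (n + 1) k s).restrictScalars F with hW
    have hJ : ∀ g ∈ skipIdeal F (n + 1) k s, g ∈ W := fun g hg => Submodule.mem_sup_right hg
    have key : ∀ i ≤ k, ∀ f, X 0 ^ (k - i) * f ∈ W := by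
      intro i
      induction i with
      | zero =>
        intro _ f
        exact hJ _ (Ideal.mul_mem_right _ _ (X_zero_pow_mem_skipIdeal n k s))
      | succ i ihi =>
        intro hi f
        set a := k - (i + 1)
        have ha : k - i = a + 1 := by omega
        rw [ha] at ihi
        obtain ⟨g, f', rfl⟩ := exists_eq_X_zero_mul_add_rename f
        rw [mul_add, ← mul_assoc, ← pow_succ]
        refine add_mem (ihi (by omega) g) ?_
        obtain ⟨c, hc, j, hj, rfl⟩ :=
          Submodule.mem_sup.1 (ih (if a < s then s - 1 else s) f')
        rw [map_add, mul_add]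
        refine add_mem ?_ ?_
        · induction hc using Submodule.span_induction with
          | zero => simp
          | add x y _ _ hx hy => rw [map_add, mul_add]; exact add_mem hx hy
          | smul r x _ hx =>
            rw [map_smul, mul_smul_comm]
            exact Submodule.smul_mem _ _ hx
          | mem x hx =>
            obtain ⟨b, hb, rfl⟩ := hx
            rw [← expMono_cons]
            exact Submodule.mem_sup_left (Submodule.subset_span
              ⟨_, cons_mem_stairs.2 ⟨by omega, hb⟩, rfl⟩)
        · obtain ⟨x, hx, y, hy, hxy⟩ := Submodule.mem_sup.1 (X_zero_pow_mul_rename_mem hk hj)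
          obtain ⟨z, rfl⟩ := Ideal.mem_span_singleton.1 hy
          rw [← hxy]
          exact add_mem (hJ x hx) (ihi (by omega) z)
    simpa using key k le_rfl f

end Ideals

section Points

variable {K : Type*}

/-- The sequence `α` with the term `α a` removed. -/
def skipSeq (α : ℕ → K) (a : ℕ) : ℕ → K := fun i => α (if i < a then i else i + 1)

lemma skipSeq_injective {α : ℕ → K} (hα : Function.Injective α) (a : ℕ) :
    Function.Injective (skipSeq α a) := by
  intro i j h
  have := hα h
  split_ifs at this <;> omega

lemma prod_range_succ_skipSeq {M : Type*} [CommMonoid M] (α : ℕ → K) (f : K → M) {a N : ℕ}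
    (h : a ≤ N) :
    ∏ j ∈ Finset.range (N + 1), f (α j) = f (α a) * ∏ j ∈ Finset.range N, f (skipSeq α a j) := by
  rw [Finset.prod_range, Finset.prod_range, Fin.prod_univ_succAbove _ ⟨a, Nat.lt_succ_of_le h⟩]
  refine congrArg _ (Finset.prod_congr rfl fun i _ => ?_)
  simp only [skipSeq, Fin.succAbove, Fin.lt_def, Fin.val_castSucc]
  split_ifs <;> rfl

lemma prod_range_skipSeq {M : Type*} [CommMonoid M] (α : ℕ → K) (f : K → M) {a N : ℕ}
    (h : N ≤ a) :
    ∏ j ∈ Finset.range N, f (skipSeq α a j) = ∏ j ∈ Finset.range N, f (α j) :=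
  Finset.prod_congr rfl fun i hi => by
    rw [skipSeq, if_pos ((Finset.mem_range.1 hi).trans_le h)]

/-- The point whose successive coordinates are chosen among the terms of `α` not used so far,
the choices being recorded by `b`. -/
def point : {n : ℕ} → (Fin n → ℕ) → (ℕ → K) → Fin n → K
  | 0, _, _ => fun i => i.elim0
  | _ + 1, b, α => Fin.cons (α (b 0)) (point (Fin.tail b) (skipSeq α (b 0)))

lemma point_cons {n : ℕ} (a : ℕ) (b : Fin n → ℕ) (α : ℕ → K) :
    point (Fin.cons a b : Fin (n + 1) → ℕ) α = Fin.cons (α a) (point b (skipSeq α a)) := rfl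

lemma point_injective {α : ℕ → K} (hα : Function.Injective α) {n : ℕ} {b b' : Fin n → ℕ}
    (h : point b α = point b' α) : b = b' := by
  induction n generalizing α with
  | zero => exact Subsingleton.elim _ _
  | succ n ih =>
    rw [← Fin.cons_self_tail b, ← Fin.cons_self_tail b', point_cons, point_cons] at h
    obtain ⟨h0, h1⟩ := Fin.cons_inj.1 h
    have h0 := hα h0
    rw [h0] at h1
    rw [← Fin.cons_self_tail b, ← Fin.cons_self_tail b', h0,
      ih (skipSeq_injective hα _) h1]

variable [Field K]

/-- The power series `1 - a t`. -/
def linFactor (a : K) : PowerSeries K := 1 - PowerSeries.C a * PowerSeries.X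

lemma coeff_mul_linFactor (p : PowerSeries K) (a : K) (d : ℕ) :
    PowerSeries.coeff (d + 1) (p * linFactor a) =
      PowerSeries.coeff (d + 1) p - a * PowerSeries.coeff d p := by
  rw [linFactor, mul_sub, mul_one, map_sub, mul_left_comm, PowerSeries.coeff_C_mul,
    PowerSeries.coeff_succ_mul_X]

lemma constantCoeff_linFactor (a : K) : PowerSeries.constantCoeff (linFactor a) = 1 := by
  simp [linFactor]

lemma coeff_prod_linFactor_eq_zero (α : ℕ → K) {N d : ℕ} (h : N < d) :
    PowerSeries.coeff d (∏ j ∈ Finset.range N, linFactor (α j)) = 0 := by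
  induction N generalizing d with
  | zero => simp [PowerSeries.coeff_one, h.ne']
  | succ N ih =>
    obtain ⟨d, rfl⟩ := Nat.exists_eq_add_of_le' (show 1 ≤ d by omega)
    rw [Finset.prod_range_succ, coeff_mul_linFactor, ih (by omega), ih (by omega), mul_zero,
      sub_zero]

variable (F : Type*) [Field F] [Algebra F K]

/-- The generating series of the values at `z` of the complete homogeneous symmetric
polynomials in the first `m` variables. -/
def hSeries {n : ℕ} (z : Fin n → K) (m : ℕ) : PowerSeries K :=
  PowerSeries.mk fun d => aeval z (hpoly F n d m)

/-- The generating series of the values at `z` of the elementary symmetric polynomials. -/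
def eSeries {n : ℕ} (z : Fin n → K) : PowerSeries K :=
  PowerSeries.mk fun d => aeval z (esymm (Fin n) F d)

lemma hSeries_cons_mul {n : ℕ} (x : K) (z : Fin n → K) (m : ℕ) :
    hSeries F (Fin.cons x z : Fin (n + 1) → K) (m + 1) * linFactor x = hSeries F z m := by
  ext d
  cases d with
  | zero => simp [hSeries, hpoly_zero, constantCoeff_linFactor, PowerSeries.coeff_mul]
  | succ d =>
    rw [coeff_mul_linFactor]
    simp [hSeries, hpoly_succ, aeval_rename, Function.comp_def]

lemma eSeries_cons {n : ℕ} (x : K) (z : Fin n → K) :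
    eSeries F (Fin.cons x z : Fin (n + 1) → K) = eSeries F z * linFactor (-x) := by
  ext d
  cases d with
  | zero => simp [eSeries, constantCoeff_linFactor, PowerSeries.coeff_mul]
  | succ d =>
    rw [coeff_mul_linFactor]
    simp [eSeries, esymm_fin_succ, aeval_rename, Function.comp_def]

lemma hSeries_zero {n : ℕ} (z : Fin n → K) : hSeries F z 0 = 1 := by
  ext d
  cases d <;> simp [hSeries, hpoly_zero, hpoly_succ_zero, PowerSeries.coeff_one]

lemma coeff_hSeries_point {k n s m : ℕ} {b : Fin n → ℕ} (α : ℕ → K) (hm : m ≤ n)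
    (hb : b ∈ stairs (k + 1) n s) :
    PowerSeries.coeff (k + 1)
      (hSeries F (point b α) m * ∏ j ∈ Finset.range (k + m), linFactor (α j)) = 0 := by
  induction m generalizing n s α with
  | zero =>
    rw [hSeries_zero, one_mul]
    exact coeff_prod_linFactor_eq_zero α (by omega)
  | succ m ih =>
    obtain ⟨n, rfl⟩ := Nat.exists_eq_add_of_le' (show 1 ≤ n by omega)
    rw [← Fin.cons_self_tail b] at hb ⊢
    obtain ⟨ha, hb⟩ := cons_mem_stairs.1 hb
    rw [point_cons, ← add_assoc, prod_range_succ_skipSeq α linFactor (show b 0 ≤ k + m by omega),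
      ← mul_assoc, hSeries_cons_mul]
    exact ih _ (by omega) hb

lemma le_of_mem_stairs {k n s : ℕ} {b : Fin n → ℕ} (hb : b ∈ stairs k n s) : s ≤ n := by
  induction n generalizing s with
  | zero => exact (mem_stairs_zero.1 hb).le
  | succ n ih =>
    rw [← Fin.cons_self_tail b] at hb
    have := ih (cons_mem_stairs.1 hb).2
    split_ifs at this <;> omega

lemma coeff_eSeries_point {k n s d : ℕ} {b : Fin n → ℕ} (α : ℕ → K) (hd : n < d + s)
    (hb : b ∈ stairs k n s) :
    PowerSeries.coeff d
      (eSeries F (point b α) * ∏ j ∈ Finset.range s, (linFactor (-α j))⁻¹) = 0 := by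
  induction n generalizing s d α with
  | zero =>
    obtain rfl := mem_stairs_zero.1 hb
    obtain ⟨d, rfl⟩ := Nat.exists_eq_add_of_le' (show 1 ≤ d by omega)
    simp [eSeries, esymm_fin_eq_zero]
  | succ n ih =>
    rw [← Fin.cons_self_tail b] at hb ⊢
    obtain ⟨_, hb⟩ := cons_mem_stairs.1 hb
    rw [point_cons, eSeries_cons]
    by_cases h : b 0 < s
    · rw [if_pos h] at hb
      obtain ⟨s, rfl⟩ := Nat.exists_eq_add_of_le' (show 1 ≤ s by omega)
      rw [prod_range_succ_skipSeq α (fun x => (linFactor (-x))⁻¹) (show b 0 ≤ s by omega),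
        ← mul_assoc, mul_assoc (eSeries F _), PowerSeries.mul_inv_cancel _ (by
          rw [constantCoeff_linFactor]; exact one_ne_zero), mul_one]
      exact ih _ (by omega) hb
    · rw [if_neg h] at hb
      have hs := le_of_mem_stairs hb
      obtain ⟨d, rfl⟩ := Nat.exists_eq_add_of_le' (show 1 ≤ d by omega)
      rw [← prod_range_skipSeq α (fun x => (linFactor (-x))⁻¹) (not_lt.1 h), mul_right_comm,
        coeff_mul_linFactor, ih _ (by omega) hb, ih _ (by omega) hb, mul_zero, sub_zero]

end Points

section HilbertSeries

variable {F : Type*} [Field F]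

lemma esymm_fin_isHomogeneous (n d : ℕ) : (esymm (Fin n) F d).IsHomogeneous d := by
  refine IsHomogeneous.sum _ _ _ fun t ht => ?_
  have := IsHomogeneous.prod (R := F) t (fun i : Fin n => X i) (fun _ => 1)
    fun i _ => isHomogeneous_X F i
  simpa [(Finset.mem_powersetCard.1 ht).2] using this

lemma homogeneousComponent_mem_skipIdeal {n k s : ℕ} {f : MvPolynomial (Fin n) F}
    (hf : f ∈ skipIdeal F n k s) (d : ℕ) : homogeneousComponent d f ∈ skipIdeal F n k s := by
  let := MvPolynomial.gradedAlgebra (σ := Fin n) (R := F)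
  refine homogeneousComponent_mem_of_mem (Ideal.homogeneous_span _ _ ?_) hf d
  rintro f (⟨m, -, rfl⟩ | ⟨d, -, rfl⟩)
  · exact ⟨k, hpoly_isHomogeneous F n k m⟩
  · exact ⟨d, esymm_fin_isHomogeneous n d⟩

lemma expMono_mem_homogeneousSubmodule {n d : ℕ} {b : Fin n → ℕ} (h : ∑ i, b i = d) :
    expMono F b ∈ homogeneousSubmodule (Fin n) F d :=
  h ▸ expMono_isHomogeneous b

lemma homogeneousComponent_mem_span_expMono {n d : ℕ} {B : Set (Fin n → ℕ)}
    {f : MvPolynomial (Fin n) F} (hf : f ∈ Submodule.span F (expMono F '' B)) :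
    homogeneousComponent d f ∈ Submodule.span F (expMono F '' {b ∈ B | ∑ i, b i = d}) := by
  induction hf using Submodule.span_induction with
  | zero => simp
  | add f g _ _ hf hg => rw [map_add]; exact add_mem hf hg
  | smul c f _ hf => rw [map_smul]; exact Submodule.smul_mem _ _ hf
  | mem f hf =>
    obtain ⟨b, hb, rfl⟩ := hf
    rw [homogeneousComponent_of_mem (expMono_isHomogeneous b)]
    split_ifs with h
    · exact Submodule.subset_span ⟨b, ⟨hb, h.symm⟩, rfl⟩
    · exact zero_mem _

lemma exists_span_expMono_add {k n s d : ℕ} (hk : 1 ≤ k)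
    {f : MvPolynomial (Fin n) F} (hf : f.IsHomogeneous d) :
    ∃ c ∈ Submodule.span F (expMono F '' {b ∈ (stairs k n s : Set (Fin n → ℕ)) | ∑ i, b i = d}),
      ∃ j ∈ skipIdeal F n k s, f = c + homogeneousComponent d j := by
  obtain ⟨c, hc, j, hj, h⟩ := Submodule.mem_sup.1 (mem_span_expMono_sup_skipIdeal hk n s f)
  refine ⟨_, homogeneousComponent_mem_span_expMono hc, j, hj, ?_⟩
  rw [← map_add, h, homogeneousComponent_eq_self hf]

variable {K : Type*} [Field K] [Algebra F K] {n : ℕ} {ι : Type*} (z : ι → Fin n → K)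

variable (F) in
/-- Evaluation of polynomials at a family of points. -/
def evalPoints : MvPolynomial (Fin n) F →ₐ[F] (ι → K) :=
  AlgHom.pi fun b => aeval (z b)

@[simp] lemma evalPoints_apply (f : MvPolynomial (Fin n) F) (b : ι) :
    evalPoints F z f b = aeval (z b) f := rfl

variable (F) in
/-- The `K`-span of the value vectors of homogeneous polynomials of degree less than `d`. -/
def valuesLT (d : ℕ) : Submodule K (ι → K) :=
  Submodule.span K {v | ∃ e < d, ∃ f : MvPolynomial (Fin n) F, f.IsHomogeneous e ∧
    v = evalPoints F z f}

lemma evalPoints_mul_mem_valuesLT {i d : ℕ} {g : MvPolynomial (Fin n) F}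
    (hg : g.IsHomogeneous i) {v : ι → K} (hv : v ∈ valuesLT F z d) :
    evalPoints F z g * v ∈ valuesLT F z (i + d) := by
  rw [valuesLT] at hv
  induction hv using Submodule.span_induction with
  | zero => simp
  | add u v _ _ hu hv => rw [mul_add]; exact add_mem hu hv
  | smul c v _ hv => rw [mul_smul_comm]; exact Submodule.smul_mem _ _ hv
  | mem v hv =>
    obtain ⟨e, he, f, hf, rfl⟩ := hv
    exact Submodule.subset_span ⟨i + e, by omega, g * f, hg.mul hf, (map_mul _ _ _).symm⟩

lemma evalPoints_mem_valuesLT_of_coeff_eq_zero {u : ℕ → MvPolynomial (Fin n) F}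
    (hu : ∀ d, (u d).IsHomogeneous d) {c : PowerSeries K}
    (hc : PowerSeries.constantCoeff c = 1) {d : ℕ}
    (h : ∀ b, PowerSeries.coeff d ((PowerSeries.mk fun i => aeval (z b) (u i)) * c) = 0) :
    evalPoints F z (u d) ∈ valuesLT F z d := by
  have key : evalPoints F z (u d) =
      -∑ i ∈ Finset.range d, PowerSeries.coeff (d - i) c • evalPoints F z (u i) := by
    ext b
    have hb := h b
    rw [PowerSeries.coeff_mul, Finset.Nat.sum_antidiagonal_eq_sum_range_succ_mk,
      Finset.sum_range_succ] at hb
    simp only [PowerSeries.coeff_mk, Nat.sub_self, PowerSeries.coeff_zero_eq_constantCoeff_apply,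
      hc, mul_one] at hb
    rw [evalPoints_apply, eq_neg_of_add_eq_zero_right hb]
    simp [mul_comm]
  rw [key]
  exact neg_mem (sum_mem fun i hi => Submodule.smul_mem _ _
    (Submodule.subset_span ⟨i, Finset.mem_range.1 hi, u i, hu i, rfl⟩))

lemma top_le_span_range_evalPoints [Fintype ι] (hz : Function.Injective z) :
    ⊤ ≤ Submodule.span K (Set.range (evalPoints F z)) := by
  by_contra hne
  obtain ⟨φ, hφ, hle⟩ := Submodule.exists_le_ker_of_lt_top _ (lt_top_iff_ne_top.2
    fun h => hne h.ge)
  have hli : LinearIndependent K fun b : ι =>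
      ((aeval (z b) : MvPolynomial (Fin n) F →ₐ[F] K) : MvPolynomial (Fin n) F → K) := by
    refine (linearIndependent_monoidHom (MvPolynomial (Fin n) F) K).comp
      (fun b => ((aeval (z b) : MvPolynomial (Fin n) F →ₐ[F] K) : MvPolynomial (Fin n) F →* K))
      fun b b' h => hz (funext fun i => ?_)
    simpa using DFunLike.congr_fun h (X i)
  refine hφ (LinearMap.pi_ext' fun b => LinearMap.ext_ring ?_)
  have := Fintype.linearIndependent_iff.1 hli (fun b => φ (Pi.single b 1)) (funext fun f => ?_) b
  · simpa using this
  · have hf : φ (evalPoints F z f) = 0 := hle (Submodule.subset_span ⟨f, rfl⟩)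
    rw [LinearMap.pi_apply_eq_sum_univ] at hf
    rw [Finset.sum_apply, Pi.zero_apply, ← hf]
    refine Finset.sum_congr rfl fun b _ => ?_
    rw [show (Pi.single b 1 : ι → K) = fun j => if b = j then 1 else 0 from
      funext fun j => by rw [Pi.single_apply]; exact if_congr eq_comm rfl rfl]
    simp [mul_comm]

section Stairs

variable {k s : ℕ} (α : ℕ → K)

/-- The family of points indexed by the exponent vectors in `stairs k n s`. -/
def stairPoint (k n s : ℕ) (α : ℕ → K) (b : stairs k n s) : Fin n → K := point b.1 α

lemma evalPoints_homogeneousComponent_mem_valuesLT (hk : 1 ≤ k) {f : MvPolynomial (Fin n) F}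
    (hf : f ∈ skipIdeal F n k s) (d : ℕ) :
    evalPoints F (stairPoint k n s α) (homogeneousComponent d f) ∈
      valuesLT F (stairPoint k n s α) d := by
  have key : ∀ {e : ℕ} {u : MvPolynomial (Fin n) F}, u.IsHomogeneous e →
      evalPoints F (stairPoint k n s α) u ∈ valuesLT F (stairPoint k n s α) e →
      ∀ (g : MvPolynomial (Fin n) F) (d : ℕ),
        evalPoints F (stairPoint k n s α) (homogeneousComponent d (g * u)) ∈
          valuesLT F (stairPoint k n s α) d := by
    intro e u hu hue g d
    rw [← sum_homogeneousComponent g, Finset.sum_mul, map_sum, map_sum]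
    refine sum_mem fun i _ => ?_
    have hi := homogeneousComponent_isHomogeneous i g
    rw [homogeneousComponent_of_mem (hi.mul hu)]
    split_ifs with h
    · rw [h, map_mul]
      exact evalPoints_mul_mem_valuesLT _ hi hue
    · rw [map_zero]
      exact zero_mem _
  suffices ∀ (g : MvPolynomial (Fin n) F) (d : ℕ),
      evalPoints F (stairPoint k n s α) (homogeneousComponent d (g * f)) ∈
        valuesLT F (stairPoint k n s α) d by simpa using this 1 d
  rw [skipIdeal] at hf
  induction hf using Submodule.span_induction with
  | zero => simp
  | add u v _ _ hu hv =>
    intro g d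
    rw [mul_add, map_add, map_add]
    exact add_mem (hu g d) (hv g d)
  | smul p u _ hu =>
    intro g d
    rw [smul_eq_mul, ← mul_assoc]
    exact hu _ d
  | mem u hu =>
    rcases hu with ⟨m, hm, rfl⟩ | ⟨e, he, rfl⟩
    · refine key (hpoly_isHomogeneous F n k m) ?_
      obtain ⟨k, rfl⟩ := Nat.exists_eq_add_of_le' hk
      refine evalPoints_mem_valuesLT_of_coeff_eq_zero _ (u := fun d => hpoly F n d m)
        (c := ∏ j ∈ Finset.range (k + m), linFactor (α j))
        (fun d => hpoly_isHomogeneous F n d m) ?_ fun b => coeff_hSeries_point F α hm b.2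
      simp [constantCoeff_linFactor]
    · refine key (esymm_fin_isHomogeneous n e) ?_
      refine evalPoints_mem_valuesLT_of_coeff_eq_zero _ (u := esymm (Fin n) F)
        (c := ∏ j ∈ Finset.range s, (linFactor (-α j))⁻¹)
        (esymm_fin_isHomogeneous n) ?_ fun b => coeff_eSeries_point F α he b.2
      simp [constantCoeff_linFactor]

lemma valuesLT_le_span_expMono (hk : 1 ≤ k) (d : ℕ) :
    valuesLT F (stairPoint k n s α) d ≤
      Submodule.span K ((fun b : stairs k n s => evalPoints F (stairPoint k n s α) (expMono F b.1))
        '' {b | ∑ i, b.1 i < d}) := by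
  induction d with
  | zero =>
    refine Submodule.span_le.2 ?_
    rintro _ ⟨e, he, -⟩
    omega
  | succ d ih =>
    refine Submodule.span_le.2 ?_
    rintro _ ⟨e, he, f, hf, rfl⟩
    have ih' := ih.trans (Submodule.span_mono (Set.image_mono
      fun b (hb : ∑ i, b.1 i < d) => Nat.lt_succ_of_lt hb))
    rcases Nat.lt_succ_iff_lt_or_eq.1 he with he | rfl
    · exact ih' (Submodule.subset_span ⟨e, he, f, hf, rfl⟩)
    · obtain ⟨c, hc, j, hj, rfl⟩ := exists_span_expMono_add (s := s) hk hf
      rw [map_add]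
      refine add_mem ?_ (ih' (evalPoints_homogeneousComponent_mem_valuesLT α hk hj e))
      clear hf
      induction hc using Submodule.span_induction with
      | zero => simp
      | add u v _ _ hu hv => rw [map_add]; exact add_mem hu hv
      | smul r u _ hu =>
        rw [map_smul, ← algebraMap_smul K r]
        exact Submodule.smul_mem _ _ hu
      | mem u hu =>
        obtain ⟨b, ⟨hb, hbe⟩, rfl⟩ := hu
        exact Submodule.subset_span ⟨⟨b, hb⟩, by simp [hbe], rfl⟩

variable {α}

lemma linearIndependent_evalPoints_expMono (hα : Function.Injective α) (hk : 1 ≤ k) :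
    LinearIndependent K fun b : stairs k n s =>
      evalPoints F (stairPoint k n s α) (expMono F b.1) := by
  refine linearIndependent_of_top_le_span_of_card_eq_finrank ?_
    (Module.finrank_fintype_fun_eq_card K).symm
  refine (top_le_span_range_evalPoints (F := F) (stairPoint k n s α)
    fun b b' h => Subtype.ext (point_injective hα h)).trans (Submodule.span_le.2 ?_)
  rintro _ ⟨f, rfl⟩
  rw [← sum_homogeneousComponent f, map_sum]
  refine sum_mem fun i _ => Submodule.span_mono (Set.image_subset_range _ _)
    (valuesLT_le_span_expMono α hk (i + 1) (Submodule.subset_span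
      ⟨i, i.lt_succ_self, _, homogeneousComponent_isHomogeneous i f, rfl⟩))

end Stairs

lemma linearIndependent_mk_expMono {k s : ℕ} (hk : 1 ≤ k) (d : ℕ) :
    LinearIndependent F fun b : (stairs k n s).filter fun b => ∑ i, b i = d =>
      Ideal.Quotient.mkₐ F (skipIdeal F n k s) (expMono F b.1) := by
  let K := AlgebraicClosure F
  let α : ℕ → K := Infinite.natEmbedding K
  have hα : Function.Injective α := (Infinite.natEmbedding K).injective
  have hli := linearIndependent_evalPoints_expMono (F := F) (n := n) (s := s) hα hk
  let incl : ((stairs k n s).filter fun b => ∑ i, b i = d) → stairs k n s := fun b =>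
    ⟨b.1, (Finset.mem_filter.1 b.2).1⟩
  have hincl : Function.Injective incl := fun b b' h =>
    Subtype.ext (congrArg (fun c : stairs k n s => c.1) h)
  refine Fintype.linearIndependent_iff.2 fun g hg => ?_
  set p : MvPolynomial (Fin n) F :=
    ∑ b : ((stairs k n s).filter fun b => ∑ i, b i = d), g b • expMono F b.1 with hp
  have hpmem : p ∈ skipIdeal F n k s := by
    rw [← Ideal.Quotient.eq_zero_iff_mem, ← Ideal.Quotient.mkₐ_eq_mk F, hp, map_sum]
    simpa using hg
  have hphom : p.IsHomogeneous d := Submodule.sum_mem (homogeneousSubmodule (Fin n) F d)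
    fun b _ => Submodule.smul_mem _ _ (expMono_mem_homogeneousSubmodule
      (Finset.mem_filter.1 b.2).2)
  have hlow := valuesLT_le_span_expMono α hk d
    (evalPoints_homogeneousComponent_mem_valuesLT α hk hpmem d)
  rw [homogeneousComponent_eq_self hphom] at hlow
  have hev : evalPoints F (stairPoint k n s α) p = ∑ b, algebraMap F K (g b) •
      evalPoints F (stairPoint k n s α) (expMono F (incl b).1) := by
    simp [hp, map_sum, incl]
  have hzero := Submodule.disjoint_def.1 (hli.disjoint_span_image
    (s := Set.range incl) (t := {b | ∑ i, b.1 i < d}) (by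
      rw [Set.disjoint_left]
      rintro _ ⟨b, rfl⟩ hb
      exact hb.ne (Finset.mem_filter.1 b.2).2)) _ (by
        rw [hev]
        exact sum_mem fun b _ => Submodule.smul_mem _ _
          (Submodule.subset_span ⟨incl b, ⟨b, rfl⟩, rfl⟩)) hlow
  intro b
  have := Fintype.linearIndependent_iff.1 (hli.comp incl hincl) _ (hev.symm.trans hzero) b
  simpa using this

lemma map_mk_homogeneousSubmodule {k s : ℕ} (hk : 1 ≤ k) (d : ℕ) :
    Submodule.map (Ideal.Quotient.mkₐ F (skipIdeal F n k s)).toLinearMap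
        (homogeneousSubmodule (Fin n) F d) =
      Submodule.span F (Set.range fun b : (stairs k n s).filter fun b => ∑ i, b i = d =>
        Ideal.Quotient.mkₐ F (skipIdeal F n k s) (expMono F b.1)) := by
  apply le_antisymm
  · rintro _ ⟨f, hf, rfl⟩
    obtain ⟨c, hc, j, hj, rfl⟩ := exists_span_expMono_add (s := s) hk hf
    have hj0 : Ideal.Quotient.mkₐ F (skipIdeal F n k s) (homogeneousComponent d j) = 0 :=
      Ideal.Quotient.eq_zero_iff_mem.2 (homogeneousComponent_mem_skipIdeal hj d)
    rw [AlgHom.toLinearMap_apply, map_add, hj0, add_zero, ← AlgHom.toLinearMap_apply]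
    have := Submodule.mem_map_of_mem
      (f := (Ideal.Quotient.mkₐ F (skipIdeal F n k s)).toLinearMap) hc
    rw [Submodule.map_span, ← Set.image_comp] at this
    refine Submodule.span_mono ?_ this
    rintro _ ⟨b, ⟨hb, hbd⟩, rfl⟩
    exact ⟨⟨b, Finset.mem_filter.2 ⟨hb, hbd⟩⟩, rfl⟩
  · refine Submodule.span_le.2 ?_
    rintro _ ⟨b, rfl⟩
    exact ⟨expMono F b.1, expMono_mem_homogeneousSubmodule (Finset.mem_filter.1 b.2).2, rfl⟩

end HilbertSeries

/-- `J_{n,k}` is a homogeneous ideal, so `S_{n,k}` is graded, and its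
Hilbert series is `rev_q([k]!_q · Stir_q(n,k))`: the dimension of the degree-`d`
component of `S_{n,k}` is the coefficient of `q^d` in the coefficient-reversal of
`[k]!_q · Stir_q(n,k)`. -/
theorem hilbert_series_Snk (F : Type*) [Field F] (n k : ℕ) (hk : 1 ≤ k) (hkn : k ≤ n) :
    (∀ f ∈ Jideal F n k, ∀ d : ℕ,
      MvPolynomial.homogeneousComponent d f ∈ Jideal F n k) ∧
    ∀ d : ℕ,
      Module.finrank F
        ↥(Submodule.map (Ideal.Quotient.mkₐ F (Jideal F n k)).toLinearMap
          (MvPolynomial.homogeneousSubmodule (Fin n) F d)) =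
      ((qfact k * qstirling n k).reverse).coeff d := by
  rw [Jideal_eq_skipIdeal F hk hkn, reverse_qfact_mul_qstirling hk hkn]
  refine ⟨fun f hf d => homogeneousComponent_mem_skipIdeal hf d, fun d => ?_⟩
  rw [map_mk_homogeneousSubmodule hk,
    finrank_span_eq_card (linearIndependent_mk_expMono hk d), Fintype.card_coe, coeff_stairPoly]

end OSPHecke
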